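/- Suppose F = F_q is the finite field with q elements and 1 < k < n−1. Then a maximal clique C of Δ_k(V) is a maximal star (i.e., C = S(X) for some non-degenerate (k−1)-dimensional subspace X of F^n) if and only if C contains exactly [n−k+1]_q elements, where [t]_q = (q^t − 1)/(q − 1). -/

import Mathlib

open Module

section Defs

variable (F : Type*) [Field F]

/-- The `i`-th coordinate hyperplane in `F^n`: the kernel of the `i`-th coordinate functional. -/
def coordHyp (n : ℕ) (i : Fin n) : Submodule F (Fin n → F) :=
  LinearMap.ker (LinearMap.proj (R := F) (φ := fun _ : Fin n => F) i)

/-- A subspace of `F^n` is degenerate if it is contained in some coordinate hyperplane. -/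
def IsDeg (n : ℕ) (W : Submodule F (Fin n → F)) : Prop :=
  ∃ i : Fin n, W ≤ coordHyp F n i

/-- A subspace of `F^n` is non-degenerate if it is not degenerate. -/
def IsNondeg (n : ℕ) (W : Submodule F (Fin n → F)) : Prop :=
  ¬ IsDeg F n W

/-- Adjacency of `k`-dimensional subspaces: distinct with `(k-1)`-dimensional intersection. -/
def AdjK (n k : ℕ) (A B : Submodule F (Fin n → F)) : Prop :=
  A ≠ B ∧ finrank F ↥(A ⊓ B) = k - 1

/-- The star `S(X)`: all `k`-dimensional subspaces containing `X`. -/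
def Sstar (n k : ℕ) (X : Submodule F (Fin n → F)) : Set (Submodule F (Fin n → F)) :=
  {A | finrank F ↥A = k ∧ X ≤ A}

/-- `S^c(X)`: all non-degenerate `k`-dimensional subspaces containing `X`. -/
def Sc (n k : ℕ) (X : Submodule F (Fin n → F)) : Set (Submodule F (Fin n → F)) :=
  {A | finrank F ↥A = k ∧ X ≤ A ∧ IsNondeg F n A}

/-- `T^c(Y)`: all non-degenerate `k`-dimensional subspaces contained in `Y`. -/
def Tc (n k : ℕ) (Y : Submodule F (Fin n → F)) : Set (Submodule F (Fin n → F)) :=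
  {A | finrank F ↥A = k ∧ A ≤ Y ∧ IsNondeg F n A}

/-- A clique of `Δ_k(V)`: a set of non-degenerate `k`-dimensional subspaces which are
pairwise adjacent. -/
def IsCliqueD (n k : ℕ) (C : Set (Submodule F (Fin n → F))) : Prop :=
  (∀ A ∈ C, finrank F ↥A = k ∧ IsNondeg F n A) ∧
    ∀ A ∈ C, ∀ B ∈ C, A ≠ B → AdjK F n k A B

/-- A maximal clique of `Δ_k(V)`. -/
def IsMaxCliqueD (n k : ℕ) (C : Set (Submodule F (Fin n → F))) : Prop :=
  IsCliqueD F n k C ∧ ∀ D, IsCliqueD F n k D → C ⊆ D → D = C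

/-- A star of `Δ_k(V)`: a set `S^c(X)` which is a maximal clique of `Δ_k(V)`. -/
def IsStarD (n k : ℕ) (S : Set (Submodule F (Fin n → F))) : Prop :=
  (∃ X : Submodule F (Fin n → F), finrank F ↥X = k - 1 ∧ S = Sc F n k X) ∧
    IsMaxCliqueD F n k S

/-- A top of `Δ_k(V)`: a set `T^c(Y)` which is a maximal clique of `Δ_k(V)`. -/
def IsTopD (n k : ℕ) (T : Set (Submodule F (Fin n → F))) : Prop :=
  (∃ Y : Submodule F (Fin n → F), finrank F ↥Y = k + 1 ∧ T = Tc F n k Y) ∧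
    IsMaxCliqueD F n k T

/-- Adjacency of maximal cliques used in the graphs `Δ_s` and `Δ_t`:
two distinct cliques such that every vertex of each is adjacent to some vertex of the other. -/
def AdjMC (n k : ℕ) (C1 C2 : Set (Submodule F (Fin n → F))) : Prop :=
  C1 ≠ C2 ∧ (∀ A ∈ C1, ∃ B ∈ C2, AdjK F n k A B) ∧
    (∀ A ∈ C2, ∃ B ∈ C1, AdjK F n k A B)

/-- Adjacency in the graphs `Δ'_s` and `Δ'_t`: adjacent as above with empty intersection. -/
def AdjMC' (n k : ℕ) (C1 C2 : Set (Submodule F (Fin n → F))) : Prop :=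
  AdjMC F n k C1 C2 ∧ C1 ∩ C2 = ∅

/-- A clique of the graph `Δ_s` (whose vertices are the stars of `Δ_k(V)`). -/
def IsCliqueDs (n k : ℕ) (𝔖 : Set (Set (Submodule F (Fin n → F)))) : Prop :=
  (∀ S ∈ 𝔖, IsStarD F n k S) ∧ ∀ S ∈ 𝔖, ∀ S' ∈ 𝔖, S ≠ S' → AdjMC F n k S S'

/-- A maximal clique of `Δ_s`. -/
def IsMaxCliqueDs (n k : ℕ) (𝔖 : Set (Set (Submodule F (Fin n → F)))) : Prop :=
  IsCliqueDs F n k 𝔖 ∧ ∀ 𝔖', IsCliqueDs F n k 𝔖' → 𝔖 ⊆ 𝔖' → 𝔖' = 𝔖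

/-- A clique of the graph `Δ'_s`. -/
def IsCliqueDs' (n k : ℕ) (𝔖 : Set (Set (Submodule F (Fin n → F)))) : Prop :=
  (∀ S ∈ 𝔖, IsStarD F n k S) ∧ ∀ S ∈ 𝔖, ∀ S' ∈ 𝔖, S ≠ S' → AdjMC' F n k S S'

/-- A maximal clique of `Δ'_s`. -/
def IsMaxCliqueDs' (n k : ℕ) (𝔖 : Set (Set (Submodule F (Fin n → F)))) : Prop :=
  IsCliqueDs' F n k 𝔖 ∧ ∀ 𝔖', IsCliqueDs' F n k 𝔖' → 𝔖 ⊆ 𝔖' → 𝔖' = 𝔖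

/-- A special set of stars: a maximal clique in both `Δ_s` and `Δ'_s`. -/
def IsSpecialStars (n k : ℕ) (𝔖 : Set (Set (Submodule F (Fin n → F)))) : Prop :=
  IsMaxCliqueDs F n k 𝔖 ∧ IsMaxCliqueDs' F n k 𝔖

/-- A clique of the graph `Δ_t` (whose vertices are the tops of `Δ_k(V)`). -/
def IsCliqueDt (n k : ℕ) (𝔗 : Set (Set (Submodule F (Fin n → F)))) : Prop :=
  (∀ T ∈ 𝔗, IsTopD F n k T) ∧ ∀ T ∈ 𝔗, ∀ T' ∈ 𝔗, T ≠ T' → AdjMC F n k T T'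

/-- A maximal clique of `Δ_t`. -/
def IsMaxCliqueDt (n k : ℕ) (𝔗 : Set (Set (Submodule F (Fin n → F)))) : Prop :=
  IsCliqueDt F n k 𝔗 ∧ ∀ 𝔗', IsCliqueDt F n k 𝔗' → 𝔗 ⊆ 𝔗' → 𝔗' = 𝔗

/-- A clique of the graph `Δ'_t`. -/
def IsCliqueDt' (n k : ℕ) (𝔗 : Set (Set (Submodule F (Fin n → F)))) : Prop :=
  (∀ T ∈ 𝔗, IsTopD F n k T) ∧ ∀ T ∈ 𝔗, ∀ T' ∈ 𝔗, T ≠ T' → AdjMC' F n k T T'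

/-- A maximal clique of `Δ'_t`. -/
def IsMaxCliqueDt' (n k : ℕ) (𝔗 : Set (Set (Submodule F (Fin n → F)))) : Prop :=
  IsCliqueDt' F n k 𝔗 ∧ ∀ 𝔗', IsCliqueDt' F n k 𝔗' → 𝔗 ⊆ 𝔗' → 𝔗' = 𝔗

/-- A special set of tops: a maximal clique in both `Δ_t` and `Δ'_t`. -/
def IsSpecialTops (n k : ℕ) (𝔗 : Set (Set (Submodule F (Fin n → F)))) : Prop :=
  IsMaxCliqueDt F n k 𝔗 ∧ IsMaxCliqueDt' F n k 𝔗

/-- `𝔗_X`: the set of all `T^c(Y)` over non-degenerate `(k+1)`-dimensional `Y` containing `X`. -/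
def TopsThrough (n k : ℕ) (X : Submodule F (Fin n → F)) :
    Set (Set (Submodule F (Fin n → F))) :=
  {T | ∃ Y : Submodule F (Fin n → F),
    finrank F ↥Y = k + 1 ∧ IsNondeg F n Y ∧ X ≤ Y ∧ T = Tc F n k Y}

end Defs
section Counting

variable {F V : Type*} [Field F] [AddCommGroup V] [Module F V]

lemma Module.card_submodule_finrank_one [Finite F] :
    Nat.card {H : Submodule F V // finrank F H = 1} =
      ∑ i ∈ Finset.range (finrank F V), Nat.card F ^ i := by
  rw [← Projectivization.card_of_finrank F V rfl]
  exact Nat.card_congr (Projectivization.equivSubmodule F V).symm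

lemma Module.card_submodule_hyperplane [Finite F] [FiniteDimensional F V] {k : ℕ}
    (h : finrank F V = k + 1) :
    Nat.card {H : Submodule F V // finrank F H = k} =
      ∑ i ∈ Finset.range (k + 1), Nat.card F ^ i := by
  rw [← h, ← Subspace.dual_finrank_eq, ← Module.card_submodule_finrank_one]
  refine Nat.card_congr (Equiv.subtypeEquiv
    (Subspace.orderIsoFiniteDimensional.toEquiv.trans OrderDual.ofDual) fun W => ?_)
  have := Subspace.finrank_add_finrank_dualAnnihilator_eq W
  change _ ↔ finrank F (Submodule.dualAnnihilator W) = 1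
  omega

lemma Submodule.ncard_hyperplanes_of_finrank [Finite F] {Y : Submodule F V}
    [FiniteDimensional F Y] {k : ℕ} (h : finrank F Y = k + 1) :
    {A : Submodule F V | finrank F A = k ∧ A ≤ Y}.ncard =
      ∑ i ∈ Finset.range (k + 1), Nat.card F ^ i := by
  rw [← Module.card_submodule_hyperplane h, ← Nat.card_coe_set_eq]
  refine Nat.card_congr (Equiv.trans ?_
    (Equiv.subtypeEquiv (p := fun A : Set.Iic Y => finrank F A.1 = k)
      Y.mapIic.symm.toEquiv fun A => ?_))
  · exact (Equiv.subtypeEquivRight fun A => and_comm).trans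
      (Equiv.subtypeSubtypeEquivSubtypeInter (· ≤ Y) (fun A => finrank F A = k)).symm
  · obtain ⟨B, rfl⟩ := Y.mapIic.surjective A
    change finrank F (B.map Y.subtype) = k ↔ finrank F (Y.mapIic.symm (Y.mapIic B)) = k
    rw [OrderIso.symm_apply_apply, Submodule.finrank_map_subtype_eq]

lemma Submodule.ncard_star_of_finrank [Finite F] [FiniteDimensional F V] {X : Submodule F V}
    {k : ℕ} (h : finrank F X + 1 = k) :
    {A : Submodule F V | finrank F A = k ∧ X ≤ A}.ncard =
      ∑ i ∈ Finset.range (finrank F V - finrank F X), Nat.card F ^ i := by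
  rw [← Submodule.finrank_quotient, ← Module.card_submodule_finrank_one, ← Nat.card_coe_set_eq]
  refine Nat.card_congr (Equiv.trans ?_
    (Equiv.subtypeEquiv (p := fun A : Set.Ici X => finrank F A.1 = k)
      (Submodule.comapMkQRelIso X).symm.toEquiv fun A => ?_))
  · exact (Equiv.subtypeEquivRight fun A => and_comm).trans
      (Equiv.subtypeSubtypeEquivSubtypeInter (X ≤ ·) (fun A => finrank F A = k)).symm
  · obtain ⟨A, hA⟩ := A
    change _ ↔ finrank F (A.map X.mkQ) = 1
    have h1 := LinearMap.finrank_range_add_finrank_ker (X.mkQ.comp A.subtype)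
    rw [LinearMap.range_comp, Submodule.range_subtype, LinearMap.ker_comp, Submodule.ker_mkQ,
      (Submodule.comapSubtypeEquivOfLe hA).finrank_eq] at h1
    change finrank F A = k ↔ _
    omega

end Counting

section Cliques

variable {F V : Type*} [Field F] [AddCommGroup V] [Module F V] [FiniteDimensional F V]

/-- If `D` meets `A` and `B` in hyperplanes of `D`, where `A ⊓ B` has the dimension of such a
hyperplane, then `D` contains `A ⊓ B` or is contained in `A ⊔ B`. -/
lemma Submodule.inf_le_or_le_sup {k : ℕ} (hk : 1 ≤ k) {A B D : Submodule F V}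
    (hD : finrank F D = k) (hAB : finrank F ↥(A ⊓ B) = k - 1)
    (hDA : finrank F ↥(D ⊓ A) = k - 1) (hDB : finrank F ↥(D ⊓ B) = k - 1) :
    A ⊓ B ≤ D ∨ D ≤ A ⊔ B := by
  by_cases h : D ⊓ A = D ⊓ B
  · left
    have h1 : D ⊓ A ≤ A ⊓ B := le_inf inf_le_right (h ▸ inf_le_right)
    rw [← Submodule.eq_of_le_of_finrank_eq h1 (by omega)]
    exact inf_le_left
  · right
    have h1 : D ⊓ A < D ⊓ A ⊔ D ⊓ B := by
      refine lt_of_le_of_ne le_sup_left fun h2 => h ?_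
      exact (Submodule.eq_of_le_of_finrank_eq (h2 ▸ le_sup_right) (by omega)).symm
    have h2 := Submodule.finrank_lt_finrank_of_lt h1
    have h3 : D ⊓ A ⊔ D ⊓ B = D :=
      Submodule.eq_of_le_of_finrank_le (sup_le inf_le_left inf_le_left) (by omega)
    rw [← h3]
    exact sup_le_sup inf_le_right inf_le_right

/-- A clique of the Grassmann graph with at least two vertices lies in a star or in a top. -/
lemma Submodule.exists_star_or_top_of_pairwise {k : ℕ} (hk : 1 ≤ k) {C : Set (Submodule F V)}
    (hdim : ∀ A ∈ C, finrank F A = k)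
    (hadj : C.Pairwise fun A B => finrank F ↥(A ⊓ B) = k - 1) (hC : C.Nontrivial) :
    (∃ X : Submodule F V, finrank F X = k - 1 ∧ ∀ A ∈ C, X ≤ A) ∨
      ∃ Y : Submodule F V, finrank F Y = k + 1 ∧ ∀ A ∈ C, A ≤ Y := by
  obtain ⟨A, hA, B, hB, hne⟩ := hC
  have hAB := hadj hA hB hne
  have key : ∀ D ∈ C, A ⊓ B ≤ D ∨ D ≤ A ⊔ B := fun D hD => by
    by_cases h1 : D = A
    · exact .inl (h1 ▸ inf_le_left)
    by_cases h2 : D = B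
    · exact .inl (h2 ▸ inf_le_right)
    exact inf_le_or_le_sup hk (hdim D hD) hAB (hadj hD hA h1) (hadj hD hB h2)
  by_cases hX : ∀ D ∈ C, A ⊓ B ≤ D
  · exact .inl ⟨_, hAB, hX⟩
  right
  push Not at hX
  obtain ⟨E, hE, hEX⟩ := hX
  have hEY := (key E hE).resolve_left hEX
  refine ⟨A ⊔ B, ?_, fun D hD => ?_⟩
  · have := Submodule.finrank_sup_add_finrank_inf_eq A B
    have := hdim A hA
    have := hdim B hB
    omega
  by_contra hDY
  have hXD := (key D hD).resolve_right hDY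
  have h1 : D ⊓ (A ⊔ B) < D := inf_lt_left.2 hDY
  have h2 := Submodule.finrank_lt_finrank_of_lt h1
  have h3 := hdim D hD
  have h4 : A ⊓ B = D ⊓ (A ⊔ B) :=
    Submodule.eq_of_le_of_finrank_le (le_inf hXD (inf_le_left.trans le_sup_left)) (by omega)
  have h5 : D ⊓ E = A ⊓ B :=
    Submodule.eq_of_le_of_finrank_eq (h4 ▸ inf_le_inf_left D hEY)
      ((hadj hD hE (by rintro rfl; exact hDY hEY)).trans hAB.symm)
  exact hEX (h5 ▸ inf_le_right)

lemma Submodule.finrank_inf_of_finrank_eq_succ {k : ℕ} {A B Y : Submodule F V}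
    (hA : finrank F A = k) (hB : finrank F B = k) (hY : finrank F Y = k + 1)
    (hAY : A ≤ Y) (hBY : B ≤ Y) (hne : A ≠ B) : finrank F ↥(A ⊓ B) = k - 1 := by
  have h1 : A < A ⊔ B := lt_of_le_of_ne le_sup_left fun h =>
    hne (Submodule.eq_of_le_of_finrank_eq (h ▸ le_sup_right) (hB.trans hA.symm)).symm
  have h2 := Submodule.finrank_lt_finrank_of_lt h1
  have h3 := Submodule.finrank_mono (sup_le hAY hBY)
  have := Submodule.finrank_sup_add_finrank_inf_eq A B
  omega

end Cliques

section Coordinate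

variable {F : Type*} [Field F] {n k : ℕ}

lemma finrank_coordHyp_add_one (i : Fin n) : finrank F (coordHyp F n i) + 1 = n := by
  have h := LinearMap.finrank_range_add_finrank_ker
    (LinearMap.proj (R := F) (φ := fun _ : Fin n => F) i)
  rw [LinearMap.range_eq_top.2 (LinearMap.proj_surjective i)] at h
  simp only [finrank_top, finrank_self, finrank_fintype_fun_eq_card, Fintype.card_fin] at h
  rw [coordHyp]
  omega

lemma finrank_inf_coordHyp {Y : Submodule F (Fin n → F)} (hY : finrank F Y = k + 1)
    (hnd : IsNondeg F n Y) (i : Fin n) : finrank F ↥(Y ⊓ coordHyp F n i) = k := by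
  have h1 : coordHyp F n i < Y ⊔ coordHyp F n i :=
    right_lt_sup.2 fun h => hnd ⟨i, h⟩
  have h2 := Submodule.finrank_lt_finrank_of_lt h1
  have h3 := Submodule.finrank_le (Y ⊔ coordHyp F n i)
  have h4 := Submodule.finrank_sup_add_finrank_inf_eq Y (coordHyp F n i)
  have h5 := finrank_coordHyp_add_one (F := F) i
  rw [finrank_fintype_fun_eq_card, Fintype.card_fin] at h3
  omega

lemma IsNondeg.mono {A B : Submodule F (Fin n → F)} (h : A ≤ B) (hA : IsNondeg F n A) :
    IsNondeg F n B :=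
  fun ⟨i, hi⟩ => hA ⟨i, h.trans hi⟩

lemma isCliqueD_Tc {Y : Submodule F (Fin n → F)} (hY : finrank F Y = k + 1) :
    IsCliqueD F n k (Tc F n k Y) :=
  ⟨fun _ hA => ⟨hA.1, hA.2.2⟩, fun _ hA _ hB hne =>
    ⟨hne, Submodule.finrank_inf_of_finrank_eq_succ hA.1 hB.1 hY hA.2.1 hB.2.1 hne⟩⟩

/-- A degenerate subspace of dimension less than `n - 1` lies in a degenerate subspace of the next
dimension. -/
lemma IsDeg.exists_le_finrank_succ {X : Submodule F (Fin n → F)} (hX : IsDeg F n X)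
    (hdim : finrank F X + 1 < n) :
    ∃ A : Submodule F (Fin n → F), X ≤ A ∧ finrank F A = finrank F X + 1 ∧ IsDeg F n A := by
  obtain ⟨i, hi⟩ := hX
  have hlt : X < coordHyp F n i := lt_of_le_of_ne hi fun h => by
    have := finrank_coordHyp_add_one (F := F) i
    rw [← h] at this
    omega
  obtain ⟨v, hv, hvX⟩ := SetLike.exists_of_lt hlt
  refine ⟨X ⊔ F ∙ v, le_sup_left, Submodule.finrank_sup_span_singleton hvX, i, sup_le hi ?_⟩
  rwa [Submodule.span_singleton_le_iff_mem]

lemma ncard_Tc_lt [Finite F] (hn : 0 < n) {Y : Submodule F (Fin n → F)}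
    (hY : finrank F Y = k + 1) (hnd : IsNondeg F n Y) :
    (Tc F n k Y).ncard < ∑ i ∈ Finset.range (k + 1), Nat.card F ^ i := by
  rw [← Submodule.ncard_hyperplanes_of_finrank hY]
  refine Set.ncard_lt_ncard ⟨fun A hA => ⟨hA.1, hA.2.1⟩, fun h => ?_⟩ (Set.toFinite _)
  exact (h ⟨finrank_inf_coordHyp hY hnd ⟨0, hn⟩, inf_le_left⟩).2.2 ⟨_, inf_le_right⟩

lemma le_ncard_Tc_add [Finite F] {Y : Submodule F (Fin n → F)}
    (hY : finrank F Y = k + 1) (hnd : IsNondeg F n Y) :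
    ∑ i ∈ Finset.range (k + 1), Nat.card F ^ i ≤ (Tc F n k Y).ncard + n := by
  rw [← Submodule.ncard_hyperplanes_of_finrank hY]
  have hsub : {A : Submodule F (Fin n → F) | finrank F A = k ∧ A ≤ Y} ⊆
      Tc F n k Y ∪ Set.range fun i => Y ⊓ coordHyp F n i := by
    rintro A ⟨hA, hAY⟩
    by_cases h : IsDeg F n A
    · obtain ⟨i, hi⟩ := h
      exact .inr ⟨i, (Submodule.eq_of_le_of_finrank_eq (le_inf hAY hi)
        (hA.trans (finrank_inf_coordHyp hY hnd i).symm)).symm⟩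
    · exact .inl ⟨hA, hAY, h⟩
  refine (Set.ncard_le_ncard hsub (Set.toFinite _)).trans ((Set.ncard_union_le _ _).trans ?_)
  gcongr
  rw [← Set.image_univ]
  exact (Set.ncard_image_le (Set.toFinite _)).trans (by simp [Set.ncard_univ])

end Coordinate

lemma geom_sum_add_lt_geom_sum {q d k : ℕ} (hq : 2 ≤ q) (hdk : d + 1 ≤ k) :
    ∑ i ∈ Finset.range (d + 1), q ^ i + (d + k) < ∑ i ∈ Finset.range (k + 1), q ^ i := by
  induction k, hdk using Nat.le_induction with
  | base =>
    rw [Finset.sum_range_succ _ (d + 1)]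
    have h1 : 2 ^ (d + 1) ≤ q ^ (d + 1) := Nat.pow_le_pow_left hq _
    have h2 : d < 2 ^ d := Nat.lt_two_pow_self
    rw [pow_succ] at h1
    omega
  | succ k _ ih =>
    rw [Finset.sum_range_succ _ (k + 1)]
    have : 0 < q ^ (k + 1) := by positivity
    omega

/-- for `F = F_q`, a maximal clique of `Δ_k(V)` is a maximal star
(i.e. equal to `S(X)` for some non-degenerate `(k-1)`-dimensional `X`) iff it contains
exactly `[n-k+1]_q` elements. -/
theorem stmt5 (F : Type*) [Field F] [Fintype F] (n k q : ℕ)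
    (hq : Fintype.card F = q) (hk1 : 1 < k) (hk2 : k < n - 1)
    (C : Set (Submodule F (Fin n → F))) (hC : IsMaxCliqueD F n k C) :
    (∃ X : Submodule F (Fin n → F),
        finrank F ↥X = k - 1 ∧ IsNondeg F n X ∧ C = Sstar F n k X) ↔
      C.ncard = ∑ i ∈ Finset.range (n - k + 1), q ^ i := by
  subst hq
  rw [← Nat.card_eq_fintype_card]
  have hcard : ∀ X : Submodule F (Fin n → F), finrank F X = k - 1 →
      (Sstar F n k X).ncard = ∑ i ∈ Finset.range (n - k + 1), Nat.card F ^ i := fun X hX => by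
    rw [Sstar, Submodule.ncard_star_of_finrank (by omega), hX, finrank_fintype_fun_eq_card,
      Fintype.card_fin, show n - (k - 1) = n - k + 1 by omega]
  constructor
  · rintro ⟨X, hX, -, rfl⟩
    exact hcard X hX
  intro hCcard
  have hq2 : 2 ≤ Nat.card F := Finite.one_lt_card
  have hnt : C.Nontrivial := by
    rw [← Set.one_lt_ncard_iff_nontrivial, hCcard,
      show n - k + 1 = n - k - 1 + 1 + 1 by omega, Finset.sum_range_succ', Finset.sum_range_succ']
    simp only [zero_add, pow_one, pow_zero]
    omega
  obtain ⟨⟨hdim, hadj⟩, hmax⟩ := hC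
  rcases Submodule.exists_star_or_top_of_pairwise hk1.le (fun A hA => (hdim A hA).1)
    (fun A hA B hB hne => (hadj A hA B hB hne).2) hnt with ⟨X, hX, hCX⟩ | ⟨Y, hY, hCY⟩
  · have hCS : C = Sstar F n k X :=
      Set.eq_of_subset_of_ncard_le (fun A hA => ⟨(hdim A hA).1, hCX A hA⟩)
        (by rw [hcard X hX, hCcard]) (Set.toFinite _)
    refine ⟨X, hX, fun hdeg => ?_, hCS⟩
    obtain ⟨A, hXA, hA, hAdeg⟩ := hdeg.exists_le_finrank_succ (by omega)
    have hAC : A ∈ C := by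
      rw [hCS]
      exact ⟨by omega, hXA⟩
    exact (hdim A hAC).2 hAdeg
  · exfalso
    have hCT : Tc F n k Y = C :=
      hmax _ (isCliqueD_Tc hY) fun A hA => ⟨(hdim A hA).1, hCY A hA, (hdim A hA).2⟩
    obtain ⟨A, hA⟩ := hnt.nonempty
    have hnd : IsNondeg F n Y := (hdim A hA).2.mono (hCY A hA)
    rw [← hCT] at hCcard
    rcases le_or_gt k (n - k) with hle | hgt
    · have h1 := ncard_Tc_lt (by omega) hY hnd
      have h2 : ∑ i ∈ Finset.range (k + 1), Nat.card F ^ i ≤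
          ∑ i ∈ Finset.range (n - k + 1), Nat.card F ^ i :=
        Finset.sum_le_sum_of_subset (Finset.range_mono (by omega))
      omega
    · have h1 := le_ncard_Tc_add hY hnd
      have h2 := geom_sum_add_lt_geom_sum hq2 hgt
      omega
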